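/- arXiv:1801.08405 — 2 statements merged into one kernel-verified Lean document; each statement's English description precedes it below -/
import Mathlib

section
/- The convex hull of a closed curve of length 1 has boundary of perimeter at most 1. -/
open Real Set

/-- projection on direction θ -/
noncomputable def prj (θ : ℝ) (v : EuclideanSpace ℝ (Fin 2)) : ℝ := cos θ * v 0 + sin θ * v 1

/-- projection on the orthogonal direction -/
noncomputable def prq (θ : ℝ) (v : EuclideanSpace ℝ (Fin 2)) : ℝ := - sin θ * v 0 + cos θ * v 1

lemma continuous_prj (θ : ℝ) : Continuous (prj θ) := by unfold prj; fun_prop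
lemma continuous_prq (θ : ℝ) : Continuous (prq θ) := by unfold prq; fun_prop
lemma prj_sub (θ : ℝ) (v w : EuclideanSpace ℝ (Fin 2)) : prj θ (v - w) = prj θ v - prj θ w := by
  simp [prj]; ring
lemma prj_add (θ : ℝ) (v w : EuclideanSpace ℝ (Fin 2)) : prj θ (v + w) = prj θ v + prj θ w := by
  simp [prj]; ring
lemma prj_smul (θ r : ℝ) (v : EuclideanSpace ℝ (Fin 2)) : prj θ (r • v) = r * prj θ v := by
  simp [prj]; ring
lemma prq_add (θ : ℝ) (v w : EuclideanSpace ℝ (Fin 2)) : prq θ (v + w) = prq θ v + prq θ w := by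
  simp [prq]; ring
lemma prq_smul (θ r : ℝ) (v : EuclideanSpace ℝ (Fin 2)) : prq θ (r • v) = r * prq θ v := by
  simp [prq]; ring

lemma ext_prj (θ : ℝ) {v w : EuclideanSpace ℝ (Fin 2)} (h1 : prj θ v = prj θ w)
    (h2 : prq θ v = prq θ w) : v = w := by
  unfold prj at h1
  unfold prq at h2
  have h := sin_sq_add_cos_sq θ
  ext i
  fin_cases i
  · show v 0 = w 0
    linear_combination cos θ * h1 - sin θ * h2 - (v 0 - w 0) * h
  · show v 1 = w 1
    linear_combination sin θ * h1 + cos θ * h2 - (v 1 - w 1) * h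

lemma abs_prj_le (θ : ℝ) (v : EuclideanSpace ℝ (Fin 2)) : |prj θ v| ≤ ‖v‖ := by
  refine abs_le_of_sq_le_sq ?_ (norm_nonneg v)
  rw [EuclideanSpace.norm_sq_eq]
  simp only [Fin.sum_univ_two, Real.norm_eq_abs, sq_abs, prj]
  nlinarith [sq_nonneg (- sin θ * v 0 + cos θ * v 1), sin_sq_add_cos_sq θ]

lemma crofton (v : EuclideanSpace ℝ (Fin 2)) :
    ∫ θ in (0:ℝ)..(2 * π), |prj θ v| = ‖v‖ * ∫ θ in (0:ℝ)..(2 * π), |cos θ| := by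
  set z : ℂ := ⟨v 0, v 1⟩ with hz
  have hn : ‖v‖ = ‖z‖ := by
    rw [EuclideanSpace.norm_eq, Complex.norm_def, Complex.normSq_apply]
    simp [Fin.sum_univ_two, hz, sq]
  have h0 : v 0 = ‖z‖ * cos z.arg := by rw [Complex.norm_mul_cos_arg]
  have h1 : v 1 = ‖z‖ * sin z.arg := by rw [Complex.norm_mul_sin_arg]
  have e : ∀ θ, |prj θ v| = ‖z‖ * |cos (θ - z.arg)| := by
    intro θ
    have e' : prj θ v = ‖z‖ * cos (θ - z.arg) := by
      rw [cos_sub, prj, h0, h1]; ring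
    rw [e', abs_mul, abs_of_nonneg (norm_nonneg z)]
  simp_rw [e]
  rw [intervalIntegral.integral_const_mul, hn]
  congr 1
  rw [intervalIntegral.integral_comp_sub_right (fun x => |cos x|)]
  have hp : Function.Periodic (fun x => |cos x|) (2 * π) := fun x => by simp
  have := hp.intervalIntegral_add_eq (0 - z.arg) 0
  convert this using 2 <;> ring

lemma cpos : 0 < ∫ θ in (0:ℝ)..(2 * π), |cos θ| := by
  apply intervalIntegral.integral_pos (by positivity) (by fun_prop) (fun x _ => abs_nonneg _)
  exact ⟨0, by simp [pi_pos.le], by simp⟩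

lemma half_nhds (K : Set (EuclideanSpace ℝ (Fin 2))) (hK : Convex ℝ K) (θ : ℝ) (δ : ℝ)
    {a b c q : EuclideanSpace ℝ (Fin 2)} (ha : a ∈ K) (hc : c ∈ K) (hq : q ∈ K)
    (hab : prj θ a = prj θ b) (hcb : prj θ c = prj θ b)
    (h1 : prq θ a < prq θ b) (h2 : prq θ b < prq θ c) (hδ : 0 < δ * (prj θ q - prj θ b)) :
    ∀ᶠ x in nhds b, 0 ≤ δ * (prj θ x - prj θ b) → x ∈ K := by
  set D := prq θ c - prq θ a with hD
  have hDpos : 0 < D := by linarith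
  set G := δ * (prj θ q - prj θ b) with hG
  set τ : EuclideanSpace ℝ (Fin 2) → ℝ := fun x => δ * (prj θ x - prj θ b) / G with hτ
  -- coefficient of c
  set B : EuclideanSpace ℝ (Fin 2) → ℝ :=
    fun x => (prq θ x - (1 - τ x) * prq θ a - τ x * prq θ q) / D with hB
  have cj := continuous_prj θ
  have cq := continuous_prq θ
  have hτc : Continuous τ := by fun_prop
  have hBc : Continuous B := by fun_prop
  have τb : τ b = 0 := by simp [hτ]
  have Bb : B b = (prq θ b - prq θ a) / D := by simp [hB, τb]
  have e1 : ∀ᶠ x in nhds b, 0 < B x := by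
    apply hBc.continuousAt.eventually (lt_mem_nhds _)
    rw [Bb]; apply div_pos <;> linarith
  have e2 : ∀ᶠ x in nhds b, 0 < 1 - τ x - B x := by
    have : Continuous fun x => 1 - τ x - B x := by fun_prop
    apply this.continuousAt.eventually (lt_mem_nhds _)
    show 0 < 1 - τ b - B b
    rw [Bb, τb, sub_zero, sub_pos, div_lt_one hDpos]; linarith
  filter_upwards [e1, e2] with x hx1 hx2 hx
  have t0 : 0 ≤ τ x := div_nonneg hx hδ.le
  have key : x = (1 - τ x - B x) • a + B x • c + τ x • q := by
    have tG : τ x * (prj θ q - prj θ b) = prj θ x - prj θ b := by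
      have hd : δ ≠ 0 := by rintro rfl; simp [hG] at hδ
      have hg : prj θ q - prj θ b ≠ 0 := by intro h; simp [hG, h] at hδ
      simp only [hτ, hG]; field_simp
    have BD : B x * D = prq θ x - (1 - τ x) * prq θ a - τ x * prq θ q := by
      simp only [hB]; field_simp
    apply ext_prj θ
    · simp only [prj_add, prj_smul, hab, hcb]; linear_combination -tG
    · simp only [prq_add, prq_smul]; rw [hD] at BD; linear_combination -BD
  rw [key]
  have := hK.sum_mem (t := Finset.univ) (w := ![1 - τ x - B x, B x, τ x]) (z := ![a, c, q])
    (by intro i _; fin_cases i <;> simp <;> linarith)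
    (by simp [Fin.sum_univ_three]) (by intro i _; fin_cases i <;> simp [ha, hc, hq])
  simpa [Fin.sum_univ_three] using this

lemma mid_interior (K : Set (EuclideanSpace ℝ (Fin 2))) (hK : Convex ℝ K) (θ : ℝ)
    {a b c p q : EuclideanSpace ℝ (Fin 2)} (ha : a ∈ K) (hc : c ∈ K) (hp : p ∈ K) (hq : q ∈ K)
    (hab : prj θ a = prj θ b) (hcb : prj θ c = prj θ b)
    (h1 : prq θ a < prq θ b) (h2 : prq θ b < prq θ c)
    (hpb : prj θ p < prj θ b) (hqb : prj θ b < prj θ q) : b ∈ interior K := by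
  rw [mem_interior_iff_mem_nhds]
  filter_upwards [half_nhds K hK θ 1 ha hc hq hab hcb h1 h2 (by linarith),
    half_nhds K hK θ (-1) ha hc hp hab hcb h1 h2 (by linarith)] with x hx hx'
  rcases le_total (prj θ b) (prj θ x) with h | h
  · exact hx (by linarith)
  · exact hx' (by linarith)

lemma interior_closure_sub (K : Set (EuclideanSpace ℝ (Fin 2))) (hK : Convex ℝ K) :
    interior (closure K) ⊆ interior K := by
  rcases (interior (closure K)).eq_empty_or_nonempty with h | h
  · rw [h]; exact empty_subset _
  have h1 : affineSpan ℝ (closure K) = ⊤ := hK.closure.interior_nonempty_iff_affineSpan_eq_top.mp h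
  have hcl : IsClosed (affineSpan ℝ K : Set (EuclideanSpace ℝ (Fin 2))) :=
    AffineSubspace.closed_of_finiteDimensional _
  have h2 : affineSpan ℝ (closure K) ≤ affineSpan ℝ K :=
    affineSpan_le.mpr (closure_minimal (subset_affineSpan ℝ K) hcl)
  have h3 : (interior K).Nonempty :=
    hK.interior_nonempty_iff_affineSpan_eq_top.mpr (top_le_iff.mp (h1 ▸ h2))
  exact (hK.interior_closure_eq_interior_of_nonempty_interior h3).le

lemma no_three (K : Set (EuclideanSpace ℝ (Fin 2))) (hK : Convex ℝ K) (θ : ℝ)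
    {a b c p q : EuclideanSpace ℝ (Fin 2)} (ha : a ∈ frontier K) (hb : b ∈ frontier K)
    (hc : c ∈ frontier K) (hp : p ∈ K) (hq : q ∈ K) {y : ℝ}
    (hay : prj θ a = y) (hby : prj θ b = y) (hcy : prj θ c = y)
    (hpb : prj θ p < y) (hqb : y < prj θ q)
    (nab : a ≠ b) (nac : a ≠ c) (nbc : b ≠ c) : False := by
  have hs : frontier K ⊆ closure K := frontier_subset_closure
  have main : ∀ a b c, a ∈ frontier K → b ∈ frontier K → c ∈ frontier K → prj θ a = y →
      prj θ b = y → prj θ c = y → prq θ a < prq θ b → prq θ b < prq θ c → False := by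
    intro a b c ha hb hc hay hby hcy h1 h2
    exact hb.2 (interior_closure_sub K hK <| mid_interior _ hK.closure θ (hs ha) (hs hc)
      (subset_closure hp) (subset_closure hq) (hay.trans hby.symm)
      (hcy.trans hby.symm) h1 h2 (by rw [hby]; exact hpb) (by rw [hby]; exact hqb))
  have q1 : prq θ a ≠ prq θ b := fun h => nab (ext_prj θ (hay.trans hby.symm) h)
  have q2 : prq θ a ≠ prq θ c := fun h => nac (ext_prj θ (hay.trans hcy.symm) h)
  have q3 : prq θ b ≠ prq θ c := fun h => nbc (ext_prj θ (hby.trans hcy.symm) h)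
  rcases lt_or_gt_of_ne q1 with h1 | h1 <;> rcases lt_or_gt_of_ne q2 with h2 | h2 <;>
    rcases lt_or_gt_of_ne q3 with h3 | h3
  · exact main a b c ha hb hc hay hby hcy h1 h3
  · exact main a c b ha hc hb hay hcy hby h2 h3
  · linarith
  · exact main c a b hc ha hb hcy hay hby h2 h1
  · exact main b a c hb ha hc hby hay hcy h1 h2
  · linarith
  · exact main b c a hb hc ha hby hcy hay h3 h2
  · exact main c b a hc hb ha hcy hby hay h3 h1

/-- Banach indicatrix bound. -/
lemma indicatrix (f : ℝ → ℝ) (hf : ContinuousOn f (Icc 0 1)) (m M : ℝ) (hmM : m ≤ M)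
    (hb : ∀ x ∈ Icc (0:ℝ) 1, f x ∈ Icc m M)
    (h3 : ∀ y ∈ Ioo m M, ∀ a b c : ℝ, a ∈ Ioo (0:ℝ) 1 → b ∈ Ioo (0:ℝ) 1 → c ∈ Ioo (0:ℝ) 1 →
      a < b → b < c → f a = y → f b = y → f c = y → False)
    (n : ℕ) (t : ℕ → ℝ) (ht : Monotone t) (htm : ∀ i, t i ∈ Icc (0:ℝ) 1) :
    ∑ i ∈ Finset.range n, |f (t (i+1)) - f (t i)| ≤ 2 * (M - m) := by
  classical
  set A : ℕ → Set ℝ := fun i => Ioo (min (f (t i)) (f (t (i+1)))) (max (f (t i)) (f (t (i+1))))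
    with hA
  have ivt : ∀ i, ∀ y ∈ A i, ∃ x ∈ Ioo (t i) (t (i+1)), f x = y := by
    intro i y hy
    have hc : ContinuousOn f (Icc (t i) (t (i+1))) :=
      hf.mono (Icc_subset_Icc (htm i).1 (htm (i+1)).2)
    have hle := ht (Nat.le_succ i)
    rcases le_total (f (t i)) (f (t (i+1))) with h | h
    · simp only [hA, min_eq_left h, max_eq_right h] at hy
      exact intermediate_value_Ioo hle hc hy
    · simp only [hA, min_eq_right h, max_eq_left h] at hy
      exact intermediate_value_Ioo' hle hc hy
  have hvol : ∀ i, ENNReal.ofReal |f (t (i+1)) - f (t i)| = ∫⁻ y, (A i).indicator 1 y := by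
    intro i
    rw [MeasureTheory.lintegral_indicator_one measurableSet_Ioo, Real.volume_Ioo, max_sub_min_eq_abs]
  have hpt : ∀ y, ∑ i ∈ Finset.range n, (A i).indicator (1 : ℝ → ENNReal) y
      ≤ (Icc m M).indicator (fun _ => 2) y := by
    intro y
    by_cases hy : y ∈ Ioo m M
    · rw [indicator_of_mem (Ioo_subset_Icc_self hy)]
      have : ∑ i ∈ Finset.range n, (A i).indicator (1 : ℝ → ENNReal) y
          = (((Finset.range n).filter (fun i => y ∈ A i)).card : ENNReal) := by
        simp only [indicator_apply, Pi.one_apply]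
        exact Finset.sum_boole _ _
      rw [this]
      suffices ((Finset.range n).filter (fun i => y ∈ A i)).card ≤ 2 by exact_mod_cast this
      by_contra! hcard
      obtain ⟨i, j, k, hi, hj, hk, hij, hik, hjk⟩ := Finset.two_lt_card_iff.mp hcard
      simp only [Finset.mem_filter] at hi hj hk
      have main : ∀ i j k, y ∈ A i → y ∈ A j → y ∈ A k → i < j → j < k → False := by
        intro i j k hi hj hk hij hjk
        obtain ⟨a, ha, fa⟩ := ivt i y hi
        obtain ⟨b, hb, fb⟩ := ivt j y hj
        obtain ⟨c, hc, fc⟩ := ivt k y hk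
        have ss : ∀ i, Ioo (t i) (t (i+1)) ⊆ Ioo 0 1 := fun i =>
          Ioo_subset_Ioo (htm i).1 (htm (i+1)).2
        exact h3 y hy a b c (ss _ ha) (ss _ hb) (ss _ hc)
          (ha.2.trans_le ((ht hij).trans hb.1.le)) (hb.2.trans_le ((ht hjk).trans hc.1.le)) fa fb fc
      have hi := hi.2
      have hj := hj.2
      have hk := hk.2
      rcases lt_or_gt_of_ne hij with h1 | h1 <;> rcases lt_or_gt_of_ne hik with h2 | h2 <;>
        rcases lt_or_gt_of_ne hjk with h3 | h3
      · exact main i j k hi hj hk h1 h3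
      · exact main i k j hi hk hj h2 h3
      · omega
      · exact main k i j hk hi hj h2 h1
      · exact main j i k hj hi hk h1 h2
      · omega
      · exact main j k i hj hk hi h3 h2
      · exact main k j i hk hj hi h3 h1
    · have : ∑ i ∈ Finset.range n, (A i).indicator (1 : ℝ → ENNReal) y = 0 := by
        apply Finset.sum_eq_zero
        intro i _
        apply indicator_of_notMem
        intro h
        apply hy
        have b1 := hb _ (htm i)
        have b2 := hb _ (htm (i+1))
        exact ⟨(le_min b1.1 b2.1).trans_lt h.1, h.2.trans_le (max_le b1.2 b2.2)⟩
      rw [this]; exact zero_le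
  have hfin : ENNReal.ofReal (∑ i ∈ Finset.range n, |f (t (i+1)) - f (t i)|)
      ≤ ENNReal.ofReal (2 * (M - m)) := by
    rw [ENNReal.ofReal_sum_of_nonneg (fun _ _ => abs_nonneg _)]
    simp_rw [hvol]
    rw [← MeasureTheory.lintegral_finsetSum _
      (fun i _ => (measurable_one.indicator measurableSet_Ioo))]
    refine (MeasureTheory.lintegral_mono hpt).trans ?_
    rw [MeasureTheory.lintegral_indicator_const measurableSet_Icc, Real.volume_Icc,
      ENNReal.ofReal_mul (by norm_num)]
    simp
  exact (ENNReal.ofReal_le_ofReal_iff (by linarith)).mp hfin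

lemma closed_sum (g : ℕ → ℝ) (N : ℕ) (h : g 0 = g N) (j k : ℕ) (hj : j ≤ N) (hk : k ≤ N) :
    2 * (g j - g k) ≤ ∑ i ∈ Finset.range N, |g (i+1) - g i| := by
  have main : ∀ j k, j ≤ k → k ≤ N → 2 * |g j - g k| ≤ ∑ i ∈ Finset.range N, |g (i+1) - g i| := by
    intro j k hjk hk
    have d : ∀ a b, a ≤ b → |g a - g b| ≤ ∑ i ∈ Finset.Ico a b, |g (i+1) - g i| := by
      intro a b hab
      have := dist_le_Ico_sum_dist g hab
      simpa [Real.dist_eq, abs_sub_comm] using this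
    have s1 := Finset.sum_Ico_consecutive (fun i => |g (i+1) - g i|) (Nat.zero_le j) hjk
    have s2 := Finset.sum_Ico_consecutive (fun i => |g (i+1) - g i|) (Nat.zero_le k) hk
    rw [Finset.range_eq_Ico]
    have d1 := d 0 j (Nat.zero_le _)
    have d2 := d j k hjk
    have d3 := d k N hk
    have : |g j - g k| ≤ |g 0 - g j| + |g k - g N| := by
      have e : g j - g k = -(g 0 - g j) - (g k - g N) := by rw [h]; ring
      rw [e]
      refine (abs_sub _ _).trans ?_
      rw [abs_neg]
    linarith
  rcases le_total j k with hjk | hjk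
  · linarith [main j k hjk hk, le_abs_self (g j - g k)]
  · linarith [main k j hjk hj, neg_abs_le (g k - g j)]

theorem convexHull_of_closed_unit_curve_perimeter_le_one
    (γ : ℝ → EuclideanSpace ℝ (Fin 2))
    (hcont : ContinuousOn γ (Icc 0 1))
    (hclosed : γ 0 = γ 1)
    (hlen : eVariationOn γ (Icc 0 1) = 1)
    (σ : ℝ → EuclideanSpace ℝ (Fin 2))
    (hσcont : ContinuousOn σ (Icc 0 1))
    (hσclosed : σ 0 = σ 1)
    (hσinj : InjOn σ (Ico 0 1))
    (hσimg : σ '' Icc 0 1 = frontier (convexHull ℝ (γ '' Icc 0 1))) :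
    eVariationOn σ (Icc 0 1) ≤ 1 := by
  set K := convexHull ℝ (γ '' Icc 0 1) with hKdef
  have hK : Convex ℝ K := convex_convexHull ℝ _
  have hσF : ∀ x ∈ Icc (0:ℝ) 1, σ x ∈ frontier K := fun x hx => hσimg ▸ mem_image_of_mem σ hx
  have hγK : ∀ x ∈ Icc (0:ℝ) 1, γ x ∈ K := fun x hx => subset_convexHull ℝ _ (mem_image_of_mem γ hx)
  refine iSup_le ?_
  rintro ⟨n, t, ht, htm⟩
  simp only
  -- real form
  suffices hreal : ∑ i ∈ Finset.range n, ‖σ (t (i+1)) - σ (t i)‖ ≤ 1 by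
    simp_rw [edist_dist, dist_eq_norm]
    rw [← ENNReal.ofReal_sum_of_nonneg (fun _ _ => norm_nonneg _)]
    exact ENNReal.ofReal_le_one.mpr hreal
  -- pointwise width bound
  have hwidth : ∀ θ, ∃ s1 ∈ Icc (0:ℝ) 1, ∃ s2 ∈ Icc (0:ℝ) 1,
      ∑ i ∈ Finset.range n, |prj θ (σ (t (i+1)) - σ (t i))|
        ≤ 2 * (prj θ (γ s1) - prj θ (γ s2)) := by
    intro θ
    have hg : ContinuousOn (fun x => prj θ (γ x)) (Icc 0 1) :=
      (continuous_prj θ).comp_continuousOn hcont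
    obtain ⟨s1, hs1, hmax⟩ := isCompact_Icc.exists_isMaxOn (nonempty_Icc.mpr zero_le_one) hg
    obtain ⟨s2, hs2, hmin⟩ := isCompact_Icc.exists_isMinOn (nonempty_Icc.mpr zero_le_one) hg
    refine ⟨s1, hs1, s2, hs2, ?_⟩
    have hbK : ∀ x ∈ closure K, prj θ x ∈ Icc (prj θ (γ s2)) (prj θ (γ s1)) := by
      have hlin : IsLinearMap ℝ (prj θ) := ⟨prj_add θ, prj_smul θ⟩
      have hcv : Convex ℝ (prj θ ⁻¹' Icc (prj θ (γ s2)) (prj θ (γ s1))) :=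
        (convex_Icc _ _).is_linear_preimage hlin
      have : K ⊆ prj θ ⁻¹' Icc (prj θ (γ s2)) (prj θ (γ s1)) := by
        apply convexHull_min _ hcv
        rintro _ ⟨x, hx, rfl⟩
        exact ⟨hmin hx, hmax hx⟩
      exact closure_minimal this (isClosed_Icc.preimage (continuous_prj θ))
    simp_rw [prj_sub]
    refine indicatrix (fun x => prj θ (σ x)) ((continuous_prj θ).comp_continuousOn hσcont)
      _ _ (hmin hs1) (fun x hx => hbK _ (frontier_subset_closure (hσF x hx))) ?_ n t ht htm
    intro y hy a b c ha hb hc hab hbc fa fb fc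
    have ne : ∀ a b, a ∈ Ioo (0:ℝ) 1 → b ∈ Ioo (0:ℝ) 1 → a < b → σ a ≠ σ b := by
      intro a b ha hb hab h
      exact hab.ne (hσinj (Ioo_subset_Ico_self ha) (Ioo_subset_Ico_self hb) h)
    exact no_three K hK θ (hσF a (Ioo_subset_Icc_self ha)) (hσF b (Ioo_subset_Icc_self hb))
      (hσF c (Ioo_subset_Icc_self hc)) (hγK s2 hs2) (hγK s1 hs1) fa fb fc hy.1 hy.2
      (ne a b ha hb hab) (ne a c ha hc (hab.trans hbc)) (ne b c hb hc hbc)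
  set C := ∫ θ in (0:ℝ)..(2 * π), |cos θ| with hC
  have hCpos : 0 < C := cpos
  set L := ∑ i ∈ Finset.range n, ‖σ (t (i+1)) - σ (t i)‖ with hL
  have hcth : ∀ v, Continuous fun θ => |prj θ v| := by intro v; unfold prj; fun_prop
  have hint : ∀ (n : ℕ) (v : ℕ → EuclideanSpace ℝ (Fin 2)),
      ∫ θ in (0:ℝ)..(2 * π), ∑ i ∈ Finset.range n, |prj θ (v i)|
        = (∑ i ∈ Finset.range n, ‖v i‖) * C := by
    intro n v
    rw [intervalIntegral.integral_finsetSum (fun i _ => (hcth (v i)).intervalIntegrable _ _),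
      Finset.sum_mul]
    exact Finset.sum_congr rfl fun i _ => crofton (v i)
  have heps : ∀ ε > 0, L * C ≤ C + 2 * π * (4 * ε) := by
    intro ε hε
    have huc := isCompact_Icc.uniformContinuousOn_of_continuous hcont
    obtain ⟨δ, hδ, hu⟩ := Metric.uniformContinuousOn_iff.mp huc ε hε
    obtain ⟨N0, hN0⟩ := exists_nat_one_div_lt hδ
    set N := N0 + 1 with hN
    have hNpos : (0:ℝ) < N := by positivity
    set r : ℕ → ℝ := fun i => min ((i:ℝ) / N) 1 with hr
    have hrmono : Monotone r := by
      intro i j hij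
      apply min_le_min_right
      gcongr
    have hrm : ∀ i, r i ∈ Icc (0:ℝ) 1 := fun i => ⟨le_min (by positivity) zero_le_one, min_le_right _ _⟩
    have hLg : ∑ i ∈ Finset.range N, ‖γ (r (i+1)) - γ (r i)‖ ≤ 1 := by
      have := eVariationOn.sum_le (f := γ) (n := N) hrmono hrm
      rw [hlen] at this
      simp_rw [edist_dist, dist_eq_norm] at this
      rw [← ENNReal.ofReal_sum_of_nonneg (fun _ _ => norm_nonneg _)] at this
      exact ENNReal.ofReal_le_one.mp this
    have happrox : ∀ s ∈ Icc (0:ℝ) 1, ∃ j ≤ N, ‖γ s - γ (r j)‖ < ε := by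
      intro s hs
      have f1 : (⌊s * N⌋₊ : ℝ) ≤ s * N := Nat.floor_le (mul_nonneg hs.1 hNpos.le)
      have f2 := Nat.lt_floor_add_one (s * N)
      have f3 : s * N ≤ N := by nlinarith [hs.2]
      refine ⟨⌊s * N⌋₊, by exact_mod_cast f1.trans f3, ?_⟩
      rw [← dist_eq_norm]
      apply hu s hs _ (hrm _)
      have e : r ⌊s * N⌋₊ = (⌊s * N⌋₊ : ℝ) / N := by
        apply min_eq_left
        rw [div_le_one hNpos]; exact f1.trans f3
      rw [e, Real.dist_eq, abs_lt]
      have g1 : (⌊s * N⌋₊ : ℝ) / N ≤ s := by rw [div_le_iff₀ hNpos]; exact f1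
      have g2 : s < (⌊s * N⌋₊ : ℝ) / N + 1 / N := by
        rw [← add_div, lt_div_iff₀ hNpos]; exact f2
      have g3 : 1 / (N:ℝ) < δ := by rw [hN]; push_cast; exact hN0
      constructor <;> linarith
    have hpt : ∀ θ, ∑ i ∈ Finset.range n, |prj θ (σ (t (i+1)) - σ (t i))|
        ≤ ∑ i ∈ Finset.range N, |prj θ (γ (r (i+1)) - γ (r i))| + 4 * ε := by
      intro θ
      obtain ⟨s1, hs1, s2, hs2, hw⟩ := hwidth θ
      obtain ⟨j, hj, hj'⟩ := happrox s1 hs1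
      obtain ⟨k, hk, hk'⟩ := happrox s2 hs2
      have hr0 : r 0 = 0 := by simp [hr]
      have hrN : r N = 1 := by simp [hr, div_self hNpos.ne']
      have := closed_sum (fun i => prj θ (γ (r i))) N (by simp only [hr0, hrN, hclosed]) j k hj hk
      simp_rw [← prj_sub] at this
      have a1 := (le_abs_self _).trans ((abs_prj_le θ (γ s1 - γ (r j))).trans hj'.le)
      have a2 := (neg_abs_le _).trans' (neg_le_neg ((abs_prj_le θ (γ s2 - γ (r k))).trans hk'.le))
      rw [prj_sub] at a1 a2 this
      linarith
    have hi1 : ∀ (n : ℕ) (v : ℕ → EuclideanSpace ℝ (Fin 2)),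
        Continuous fun θ => ∑ i ∈ Finset.range n, |prj θ (v i)| := fun n v =>
      continuous_finsetSum _ fun i _ => hcth (v i)
    have hI := intervalIntegral.integral_mono (μ := MeasureTheory.volume) (a := 0) (b := 2 * π)
      (by positivity)
      ((hi1 n (fun i => σ (t (i+1)) - σ (t i))).intervalIntegrable _ _)
      (((hi1 N (fun i => γ (r (i+1)) - γ (r i))).add continuous_const).intervalIntegrable _ _) hpt
    simp only [Pi.add_apply] at hI
    rw [intervalIntegral.integral_add ((hi1 N (fun i => γ (r (i+1)) - γ (r i))).intervalIntegrable _ _)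
      (continuous_const.intervalIntegrable _ _), hint n (fun i => σ (t (i+1)) - σ (t i)),
      hint N (fun i => γ (r (i+1)) - γ (r i)), intervalIntegral.integral_const, sub_zero,
      smul_eq_mul] at hI
    have := mul_le_mul_of_nonneg_right hLg hCpos.le
    linarith
  have hfin : L * C ≤ C := by
    apply le_of_forall_pos_le_add
    intro ε hε
    have := heps (ε / (8 * π)) (by positivity)
    have e : 2 * π * (4 * (ε / (8 * π))) = ε := by field_simp; norm_num
    rwa [e] at this
  nlinarith
end

section
/- Every closed curve of length 1 in the plane fits in the 1/π × √(1/4 − 1/π²) rectangle: there is an isometry of ℝ² carrying the image of the curve into [0, 1/π] × [0, √(1/4 − 1/π²)]. -/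
open Real Set

/-- A finite closed real sequence has total variation at least twice its oscillation. -/
lemma two_osc_le (x : ℕ → ℝ) (N : ℕ) (h : x 0 = x N) (i j : ℕ) (hi : i ≤ N) (hj : j ≤ N) :
    2 * (x i - x j) ≤ ∑ k ∈ Finset.range N, |x (k + 1) - x k| := by
  have main : ∀ i j : ℕ, i ≤ j → j ≤ N →
      2 * |x i - x j| ≤ ∑ k ∈ Finset.range N, |x (k + 1) - x k| := by
    intro i j hij hj
    have e : ∀ k, |x (k + 1) - x k| = dist (x k) (x (k + 1)) := by
      intro k
      rw [dist_comm, Real.dist_eq]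
    simp_rw [e]
    have h1 := dist_le_Ico_sum_dist x (Nat.zero_le i)
    have h2 := dist_le_Ico_sum_dist x hij
    have h3 := dist_le_Ico_sum_dist x hj
    have s1 := Finset.sum_Ico_consecutive (fun k => dist (x k) (x (k + 1))) (Nat.zero_le i) hij
    have s2 := Finset.sum_Ico_consecutive (fun k => dist (x k) (x (k + 1))) (Nat.zero_le j) hj
    rw [Finset.range_eq_Ico]
    have t := dist_triangle_left (x i) (x j) (x 0)
    have h3' : dist (x 0) (x j) = dist (x j) (x N) := by rw [h, dist_comm]
    rw [← Real.dist_eq]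
    linarith
  have hle := le_abs_self (x i - x j)
  rcases le_total i j with hij | hij
  · have := main i j hij hj
    linarith
  · have := main j i hij hi
    rw [abs_sub_comm] at this
    linarith

lemma integral_abs_cos : ∫ θ in (0 : ℝ)..π, |cos θ| = 2 := by
  have hp : Function.Periodic (fun θ : ℝ => |cos θ|) π := by
    intro θ
    simp [Real.cos_add_pi]
  have h := hp.intervalIntegral_add_eq 0 (-(π / 2))
  rw [zero_add] at h
  rw [h, show -(π / 2) + π = π / 2 by ring]
  have : ∫ θ in (-(π / 2))..(π / 2), |cos θ| = ∫ θ in (-(π / 2))..(π / 2), cos θ := by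
    apply intervalIntegral.integral_congr
    intro θ hθ
    rw [uIcc_of_le (by linarith [pi_pos])] at hθ
    exact abs_of_nonneg (cos_nonneg_of_mem_Icc hθ)
  rw [this, integral_cos]
  simp
  norm_num

lemma integral_abs_proj (a b : ℝ) :
    ∫ θ in (0 : ℝ)..π, |cos θ * a + sin θ * b| = 2 * √(a ^ 2 + b ^ 2) := by
  set z : ℂ := ⟨a, b⟩
  have hr : ‖z‖ = √(a ^ 2 + b ^ 2) := by
    rw [Complex.norm_eq_sqrt_sq_add_sq]
  have ha : a = ‖z‖ * cos z.arg := (Complex.norm_mul_cos_arg z).symm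
  have hb : b = ‖z‖ * sin z.arg := (Complex.norm_mul_sin_arg z).symm
  rw [← hr]
  have e : ∀ θ : ℝ, |cos θ * a + sin θ * b| = ‖z‖ * |cos (θ - z.arg)| := by
    intro θ
    have : cos θ * a + sin θ * b = ‖z‖ * cos (θ - z.arg) := by
      rw [cos_sub]
      linear_combination cos θ * ha + sin θ * hb
    rw [this, abs_mul, abs_norm]
  simp_rw [e]
  rw [intervalIntegral.integral_const_mul,
    intervalIntegral.integral_comp_sub_right (fun θ => |cos θ|) z.arg]
  have hp : Function.Periodic (fun θ : ℝ => |cos θ|) π := by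
    intro θ
    simp [Real.cos_add_pi]
  have h := hp.intervalIntegral_add_eq (0 - z.arg) 0
  rw [show 0 - z.arg + π = π - z.arg by ring, zero_add] at h
  rw [h, integral_abs_cos]
  ring

/-- Support function of the curve `(X, Y)` on `[0,1]`. -/
noncomputable def supp (X Y : ℝ → ℝ) (θ : ℝ) : ℝ :=
  sSup ((fun t => cos θ * X t + sin θ * Y t) '' Icc 0 1)

lemma supp_continuous {X Y : ℝ → ℝ} (hX : Continuous X) (hY : Continuous Y) :
    Continuous (supp X Y) := by
  have := IsCompact.continuous_sSup (f := fun (θ t : ℝ) => cos θ * X t + sin θ * Y t)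
    (isCompact_Icc (a := (0 : ℝ)) (b := 1))
    (show Continuous (fun p : ℝ × ℝ => cos p.1 * X p.2 + sin p.1 * Y p.2) by fun_prop)
  exact this

lemma le_supp {X Y : ℝ → ℝ} (hX : Continuous X) (hY : Continuous Y) (θ t : ℝ)
    (ht : t ∈ Icc (0 : ℝ) 1) : cos θ * X t + sin θ * Y t ≤ supp X Y θ := by
  apply le_csSup
  · apply (isCompact_Icc.image (by fun_prop)).bddAbove
  · exact ⟨t, ht, rfl⟩

lemma supp_attained {X Y : ℝ → ℝ} (hX : Continuous X) (hY : Continuous Y) (θ : ℝ) :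
    ∃ t ∈ Icc (0 : ℝ) 1, cos θ * X t + sin θ * Y t = supp X Y θ := by
  have hc : IsCompact ((fun t => cos θ * X t + sin θ * Y t) '' Icc (0 : ℝ) 1) :=
    isCompact_Icc.image (by fun_prop)
  have := hc.sSup_mem ⟨_, 0, by simp, rfl⟩
  obtain ⟨t, ht, h⟩ := this
  exact ⟨t, ht, h⟩

/-- Width of the curve in direction `θ`. -/
noncomputable def wid (X Y : ℝ → ℝ) (θ : ℝ) : ℝ := supp X Y θ + supp X Y (θ + π)

lemma wid_continuous {X Y : ℝ → ℝ} (hX : Continuous X) (hY : Continuous Y) :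
    Continuous (wid X Y) := by
  have := supp_continuous hX hY
  unfold wid
  fun_prop

lemma wid_nonneg {X Y : ℝ → ℝ} (hX : Continuous X) (hY : Continuous Y) (θ : ℝ) :
    0 ≤ wid X Y θ := by
  have h1 := le_supp hX hY θ 0 (by simp)
  have h2 := le_supp hX hY (θ + π) 0 (by simp)
  rw [cos_add_pi, sin_add_pi] at h2
  unfold wid
  linarith

lemma mesh {X : ℝ → ℝ × ℝ} (hX : Continuous X) {δ : ℝ} (hδ : 0 < δ) :
    ∃ N : ℕ, 0 < N ∧ ∀ t ∈ Icc (0 : ℝ) 1, ∃ k : ℕ, k ≤ N ∧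
      dist (X t) (X (k / N)) ≤ δ := by
  have hu := isCompact_Icc.uniformContinuousOn_of_continuous (hX.continuousOn (s := Icc (0 : ℝ) 1))
  rw [Metric.uniformContinuousOn_iff] at hu
  obtain ⟨η, hη, h⟩ := hu δ hδ
  obtain ⟨n, hn⟩ := exists_nat_gt (1 / η)
  obtain ⟨N, hN⟩ : ∃ N : ℕ, n + 1 ≤ N := ⟨_, le_rfl⟩
  refine ⟨N, by omega, fun t ht => ⟨⌊t * N⌋₊, ?_, ?_⟩⟩
  · apply Nat.floor_le_of_le
    nlinarith [ht.2, (Nat.cast_nonneg N : (0 : ℝ) ≤ N)]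
  · have hN' : (n : ℝ) + 1 ≤ N := by exact_mod_cast hN
    have hNp : (0 : ℝ) < N := by linarith [(Nat.cast_nonneg n : (0 : ℝ) ≤ n)]
    have f1 := Nat.floor_le (mul_nonneg ht.1 hNp.le)
    have f2 := Nat.lt_floor_add_one (t * N)
    have g1 : (⌊t * N⌋₊ : ℝ) / N ≤ t := by rwa [div_le_iff₀ hNp]
    have g2 : t - (⌊t * N⌋₊ : ℝ) / N < η := by
      have : 1 < η * N := by
        rw [div_lt_iff₀ hη] at hn
        nlinarith
      have e : t - (⌊t * N⌋₊ : ℝ) / N = (t * N - ⌊t * N⌋₊) / N := by field_simp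
      rw [e, div_lt_iff₀ hNp]
      linarith
    have := h t ht (⌊t * N⌋₊ / N) ⟨by positivity, g1.trans ht.2⟩
      (by rw [Real.dist_eq, abs_of_nonneg (by linarith)]; exact g2)
    exact this.le

/-- Key approximation: one inscribed polygon nearly realizes the width in all directions. -/
lemma key {X Y : ℝ → ℝ} (hX : Continuous X) (hY : Continuous Y) (hX01 : X 0 = X 1)
    (hY01 : Y 0 = Y 1) {δ : ℝ} (hδ : 0 < δ) :
    ∃ N : ℕ, 0 < N ∧ ∀ θ : ℝ, 2 * wid X Y θ ≤ ∑ k ∈ Finset.range N,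
      |cos θ * (X ((k + 1 : ℕ) / N) - X (k / N)) + sin θ * (Y ((k + 1 : ℕ) / N) - Y (k / N))|
        + 8 * δ := by
  obtain ⟨N, hN, h⟩ := mesh (X := fun t => (X t, Y t)) (by fun_prop) hδ
  refine ⟨N, hN, fun θ => ?_⟩
  have hNp : (N : ℝ) ≠ 0 := by positivity
  set x : ℕ → ℝ := fun k => cos θ * X (k / N) + sin θ * Y (k / N) with hx
  have happ : ∀ t ∈ Icc (0 : ℝ) 1, ∃ k : ℕ, k ≤ N ∧
      |cos θ * X t + sin θ * Y t - x k| ≤ 2 * δ := by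
    intro t ht
    obtain ⟨k, hk, hd⟩ := h t ht
    refine ⟨k, hk, ?_⟩
    rw [Prod.dist_eq, max_le_iff, Real.dist_eq, Real.dist_eq] at hd
    obtain ⟨h1, h2⟩ := hd
    have e : cos θ * X t + sin θ * Y t - x k
        = cos θ * (X t - X (k / N)) + sin θ * (Y t - Y (k / N)) := by
      simp only [hx]; ring
    rw [e]
    refine (abs_add_le _ _).trans ?_
    rw [abs_mul, abs_mul]
    have c1 := abs_cos_le_one θ
    have c2 := abs_sin_le_one θ
    have := mul_le_mul c1 h1 (abs_nonneg _) zero_le_one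
    have := mul_le_mul c2 h2 (abs_nonneg _) zero_le_one
    linarith
  obtain ⟨s, hs, hs'⟩ := supp_attained hX hY θ
  obtain ⟨t, ht, ht'⟩ := supp_attained hX hY (θ + π)
  obtain ⟨i, hi, hi'⟩ := happ s hs
  obtain ⟨j, hj, hj'⟩ := happ t ht
  rw [cos_add_pi, sin_add_pi] at ht'
  have hosc := two_osc_le x N (by simp [hx, hX01, hY01, div_self hNp]) i j hi hj
  have e : ∀ k : ℕ, x (k + 1) - x k = cos θ * (X ((k + 1 : ℕ) / N) - X (k / N)) +
      sin θ * (Y ((k + 1 : ℕ) / N) - Y (k / N)) := by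
    intro k
    simp only [hx]; ring
  simp_rw [e] at hosc
  have a1 := (abs_le.1 hi').2
  have a2 := (abs_le.1 hj').1
  unfold wid
  linarith

/-- The inscribed polygons of the curve `(X, Y)` have length at most one. -/
def ShortPolys (X Y : ℝ → ℝ) : Prop := ∀ N : ℕ, 0 < N → ∑ k ∈ Finset.range N,
    √((X ((k + 1 : ℕ) / N) - X (k / N)) ^ 2 + (Y ((k + 1 : ℕ) / N) - Y (k / N)) ^ 2) ≤ 1

lemma integral_wid_le {X Y : ℝ → ℝ} (hX : Continuous X) (hY : Continuous Y) (hX01 : X 0 = X 1)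
    (hY01 : Y 0 = Y 1) (hs : ShortPolys X Y) : ∫ θ in (0 : ℝ)..π, wid X Y θ ≤ 1 := by
  have hw := wid_continuous hX hY
  apply le_of_forall_pos_le_add
  intro ε hε
  have hδ : 0 < ε / (4 * π) := by have := pi_pos; positivity
  obtain ⟨N, hN, h⟩ := key hX hY hX01 hY01 hδ
  have h1 := intervalIntegral.integral_mono_on (a := 0) (b := π) (μ := MeasureTheory.volume)
    pi_pos.le (Continuous.intervalIntegrable (by fun_prop) _ _)
    (Continuous.intervalIntegrable (by fun_prop) _ _) (fun θ _ => h θ)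
  rw [intervalIntegral.integral_const_mul, intervalIntegral.integral_add
    (Continuous.intervalIntegrable (by fun_prop) _ _)
    (Continuous.intervalIntegrable (by fun_prop) _ _),
    intervalIntegral.integral_finsetSum
      (fun i _ => Continuous.intervalIntegrable (by fun_prop) _ _)] at h1
  simp_rw [integral_abs_proj] at h1
  rw [← Finset.mul_sum, intervalIntegral.integral_const] at h1
  have h2 := hs N hN
  have h3 : (π - 0) • (8 * (ε / (4 * π))) = 2 * ε := by
    have := pi_pos
    simp only [smul_eq_mul]; field_simp; ring
  rw [h3] at h1
  linarith

lemma exists_wid_le {X Y : ℝ → ℝ} (hX : Continuous X) (hY : Continuous Y) (hX01 : X 0 = X 1)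
    (hY01 : Y 0 = Y 1) (hs : ShortPolys X Y) : ∃ θ, wid X Y θ ≤ 1 / π := by
  by_contra! hcon
  have hw := wid_continuous hX hY
  have h := intervalIntegral.integral_lt_integral_of_continuousOn_of_le_of_exists_lt pi_pos
    (f := fun _ => 1 / π) (g := wid X Y) (by fun_prop) hw.continuousOn
    (fun θ _ => (hcon θ).le) ⟨0, ⟨le_rfl, pi_pos.le⟩, hcon 0⟩
  rw [intervalIntegral.integral_const, smul_eq_mul, sub_zero, mul_one_div_cancel pi_ne_zero] at h
  exact absurd (integral_wid_le hX hY hX01 hY01 hs) (not_le.2 h)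

lemma proj_bound (a b θ x y : ℝ) :
    a * |cos θ * x + sin θ * y| + b * |-sin θ * x + cos θ * y|
      ≤ √(a ^ 2 + b ^ 2) * √(x ^ 2 + y ^ 2) := by
  rw [← sqrt_mul (by positivity)]
  apply le_sqrt_of_sq_le
  have hsc := sin_sq_add_cos_sq θ
  set u := |cos θ * x + sin θ * y|
  set v := |-sin θ * x + cos θ * y|
  have h : x ^ 2 + y ^ 2 = u ^ 2 + v ^ 2 := by
    rw [sq_abs, sq_abs]
    linear_combination -(x ^ 2 + y ^ 2) * hsc
  rw [h]
  nlinarith [sq_nonneg (a * v - b * u)]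

lemma wid_sq_add_sq {X Y : ℝ → ℝ} (hX : Continuous X) (hY : Continuous Y) (hX01 : X 0 = X 1)
    (hY01 : Y 0 = Y 1) (hs : ShortPolys X Y) (θ : ℝ) :
    wid X Y θ ^ 2 + wid X Y (θ + π / 2) ^ 2 ≤ 1 / 4 := by
  set a := wid X Y θ with ha
  set b := wid X Y (θ + π / 2) with hb
  have ha0 : 0 ≤ a := wid_nonneg hX hY _
  have hb0 : 0 ≤ b := wid_nonneg hX hY _
  set r := √(a ^ 2 + b ^ 2) with hr
  have hr0 : 0 ≤ r := sqrt_nonneg _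
  have hr2 : r ^ 2 = a ^ 2 + b ^ 2 := sq_sqrt (by positivity)
  have main : 2 * (a ^ 2 + b ^ 2) ≤ r := by
    apply le_of_forall_pos_le_add
    intro ε hε
    have hδ : 0 < ε / (8 * (a + b + 1)) := by positivity
    obtain ⟨N, hN, h⟩ := key hX hY hX01 hY01 hδ
    have h1 := mul_le_mul_of_nonneg_left (h θ) ha0
    have h2 := mul_le_mul_of_nonneg_left (h (θ + π / 2)) hb0
    rw [cos_add_pi_div_two, sin_add_pi_div_two] at h2
    rw [mul_add, Finset.mul_sum] at h1 h2
    have h3 := mul_le_mul_of_nonneg_left (hs N hN) hr0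
    rw [Finset.mul_sum] at h3
    have h4 := Finset.sum_le_sum (s := Finset.range N) (fun k _ =>
      proj_bound a b θ (X ((k + 1 : ℕ) / N) - X (k / N)) (Y ((k + 1 : ℕ) / N) - Y (k / N)))
    rw [Finset.sum_add_distrib] at h4
    have h5 : a * (8 * (ε / (8 * (a + b + 1)))) + b * (8 * (ε / (8 * (a + b + 1)))) ≤ ε := by
      have : a * (8 * (ε / (8 * (a + b + 1)))) + b * (8 * (ε / (8 * (a + b + 1))))
        = ε * ((a + b) / (a + b + 1)) := by field_simp
      rw [this]
      have : (a + b) / (a + b + 1) ≤ 1 := by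
        rw [div_le_one (by positivity)]; linarith
      nlinarith
    rw [← ha] at h1
    rw [← hb] at h2
    linarith
  nlinarith

/-- The final rigid motion. -/
noncomputable def motion (θ p q : ℝ) : EuclideanSpace ℝ (Fin 2) ≃ᵢ EuclideanSpace ℝ (Fin 2) :=
  IsometryEquiv.mk'
    (fun v => !₂[cos θ * v 0 + sin θ * v 1 + p, -sin θ * v 0 + cos θ * v 1 + q])
    (fun v => !₂[cos θ * (v 0 - p) - sin θ * (v 1 - q), sin θ * (v 0 - p) + cos θ * (v 1 - q)])
    (by
      intro v
      have := sin_sq_add_cos_sq θ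
      ext i
      fin_cases i
      · simp
        linear_combination (v 0 - p) * this
      · simp
        linear_combination (v 1 - q) * this)
    (by
      apply Isometry.of_dist_eq
      intro v w
      have := sin_sq_add_cos_sq θ
      rw [EuclideanSpace.dist_eq, EuclideanSpace.dist_eq]
      congr 1
      simp only [Fin.sum_univ_two, Real.dist_eq, sq_abs]
      simp
      linear_combination ((v 0 - w 0) ^ 2 + (v 1 - w 1) ^ 2) * this)

/-- Schaer–Wetzel: every closed curve of length 1 fits in the
`1/π × √(1/4 − 1/π²)` rectangle, up to an isometry of the plane. -/
theorem closed_unit_curve_fits_in_rectangle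
    (γ : ℝ → EuclideanSpace ℝ (Fin 2))
    (hcont : ContinuousOn γ (Icc 0 1))
    (hclosed : γ 0 = γ 1)
    (hlen : eVariationOn γ (Icc 0 1) = 1) :
    ∃ f : EuclideanSpace ℝ (Fin 2) ≃ᵢ EuclideanSpace ℝ (Fin 2),
      f '' (γ '' Icc 0 1) ⊆
        {p : EuclideanSpace ℝ (Fin 2) |
          p 0 ∈ Icc 0 (1 / π) ∧ p 1 ∈ Icc 0 (Real.sqrt (1 / 4 - 1 / π ^ 2))} := by
  set G : ℝ → EuclideanSpace ℝ (Fin 2) :=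
    IccExtend (zero_le_one (α := ℝ)) ((Icc 0 1).restrict γ) with hG
  have hGc : Continuous G := (continuousOn_iff_continuous_restrict.1 hcont).Icc_extend'
  have hGe : ∀ t ∈ Icc (0 : ℝ) 1, G t = γ t := by
    intro t ht
    rw [hG, IccExtend_of_mem _ _ ht]
    rfl
  set X : ℝ → ℝ := fun t => G t 0 with hXd
  set Y : ℝ → ℝ := fun t => G t 1 with hYd
  have hX : Continuous X := by fun_prop
  have hY : Continuous Y := by fun_prop
  have h01 : G 0 = G 1 := by rw [hGe 0 (by simp), hGe 1 (by simp), hclosed]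
  have hX01 : X 0 = X 1 := by simp only [hXd, h01]
  have hY01 : Y 0 = Y 1 := by simp only [hYd, h01]
  have hs : ShortPolys X Y := by
    intro N hN
    have hNp : (0 : ℝ) < N := by exact_mod_cast hN
    have hmem : ∀ k : ℕ, k ≤ N → (k / N : ℝ) ∈ Icc (0 : ℝ) 1 := by
      intro k hk
      refine ⟨by positivity, ?_⟩
      rw [div_le_one hNp]
      exact_mod_cast hk
    have hv := eVariationOn.sum_le_of_monotoneOn_Iic (f := γ) (s := Icc (0 : ℝ) 1) (n := N)
      (u := fun k : ℕ => (k / N : ℝ))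
      (by
        intro i _ j _ hij
        have : (i : ℝ) ≤ j := by exact_mod_cast hij
        show (i / N : ℝ) ≤ j / N
        gcongr)
      (fun i hi => hmem i hi)
    rw [hlen] at hv
    have he : ∀ k ∈ Finset.range N, edist (γ ((k + 1 : ℕ) / N)) (γ (k / N)) =
        ENNReal.ofReal (√((X ((k + 1 : ℕ) / N) - X (k / N)) ^ 2 +
          (Y ((k + 1 : ℕ) / N) - Y (k / N)) ^ 2)) := by
      intro k hk
      have hk' := Finset.mem_range.1 hk
      rw [edist_dist, EuclideanSpace.dist_eq]
      simp only [Fin.sum_univ_two, Real.dist_eq, sq_abs, hXd, hYd]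
      rw [hGe _ (hmem k (by omega)), hGe _ (hmem (k + 1) (by omega))]
    rw [Finset.sum_congr rfl he, ← ENNReal.ofReal_sum_of_nonneg (fun _ _ => sqrt_nonneg _)] at hv
    exact ENNReal.ofReal_le_one.1 hv
  obtain ⟨θ, h1, h2⟩ : ∃ θ, wid X Y θ ≤ 1 / π ∧
      wid X Y (θ + π / 2) ≤ √(1 / 4 - 1 / π ^ 2) := by
    by_cases hc : ∃ θ, 1 / π ≤ wid X Y θ
    · obtain ⟨θ, hθ⟩ := mem_range_of_exists_le_of_exists_ge (wid_continuous hX hY)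
        (exists_wid_le hX hY hX01 hY01 hs) hc
      refine ⟨θ, hθ.le, ?_⟩
      apply le_sqrt_of_sq_le
      have := wid_sq_add_sq hX hY hX01 hY01 hs θ
      rw [hθ, one_div_pow] at this
      linarith
    · push Not at hc
      refine ⟨0, (hc 0).le, (hc _).le.trans ?_⟩
      apply le_sqrt_of_sq_le
      rw [one_div_pow]
      have : 1 / π ^ 2 ≤ 1 / 8 := by
        apply one_div_le_one_div_of_le (by norm_num)
        nlinarith [pi_gt_three]
      linarith
  refine ⟨motion θ (supp X Y (θ + π)) (supp X Y (θ + π / 2 + π)), ?_⟩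
  rintro _ ⟨_, ⟨t, ht, rfl⟩, rfl⟩
  have ex : X t = γ t 0 := by simp only [hXd, hGe t ht]
  have ey : Y t = γ t 1 := by simp only [hYd, hGe t ht]
  have b1 := le_supp hX hY θ t ht
  have b2 := le_supp hX hY (θ + π) t ht
  have b3 := le_supp hX hY (θ + π / 2) t ht
  have b4 := le_supp hX hY (θ + π / 2 + π) t ht
  rw [cos_add_pi, sin_add_pi] at b2 b4
  rw [cos_add_pi_div_two, sin_add_pi_div_two] at b3 b4
  unfold wid at h1 h2
  rw [ex, ey] at b1 b2 b3 b4
  have m0 : (motion θ (supp X Y (θ + π)) (supp X Y (θ + π / 2 + π)) (γ t)) 0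
    = cos θ * γ t 0 + sin θ * γ t 1 + supp X Y (θ + π) := rfl
  have m1 : (motion θ (supp X Y (θ + π)) (supp X Y (θ + π / 2 + π)) (γ t)) 1
    = -sin θ * γ t 0 + cos θ * γ t 1 + supp X Y (θ + π / 2 + π) := rfl
  simp only [mem_setOf_eq, m0, m1, mem_Icc]
  refine ⟨⟨?_, ?_⟩, ?_, ?_⟩ <;> linarith
end
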